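/- Let α ∈ (−1/2, 0), let ρ_α(j) = (1/2)((j−1)^{2α+1} − 2·j^{2α+1} + (j+1)^{2α+1}) for integers j ≥ 1, let γ be the standard Gaussian measure N(0,1) on ℝ, and for k ≥ 1 let a_k = (1/k!)·∫ (x²·1_{[0,∞)}(x) − 1/2)·H_k(x) dγ(x), where H_k is the k-th probabilists' Hermite polynomial. Then the series β = ∑_{k=1}^{∞} k!·a_k²·(1 + 2·∑_{i=1}^{∞} ρ_α(i)^k) converges (in particular each inner series ∑_i ρ_α(i)^k converges absolutely). -/

import Mathlib

open MeasureTheory ProbabilityTheory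

section GaussianHermite

open Polynomial

lemma integrable_aeval_gaussianReal (p : ℤ[X]) :
    Integrable (fun x : ℝ => aeval x p) (gaussianReal 0 1) := by
  induction p using Polynomial.induction_on' with
  | add p q hp hq => exact (hp.add hq).congr (.of_forall fun x => (map_add _ p q).symm)
  | monomial n c =>
    have h : Integrable (fun x : ℝ => x ^ n) (gaussianReal 0 1) := by
      rcases Nat.eq_zero_or_pos n with rfl | hn
      · simp
      · have hm := (memLp_id_gaussianReal (μ := 0) (v := 1) n).integrable_norm_pow hn.ne'
        refine hm.mono' (by fun_prop) (.of_forall fun x => ?_)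
        simp
    simpa [aeval_monomial] using h.const_mul (c : ℝ)

lemma memLp_two_aeval_gaussianReal (p : ℤ[X]) :
    MemLp (fun x : ℝ => aeval x p) 2 (gaussianReal 0 1) := by
  rw [memLp_two_iff_integrable_sq (integrable_aeval_gaussianReal p).aestronglyMeasurable]
  exact (integrable_aeval_gaussianReal (p ^ 2)).congr (.of_forall fun x => map_pow _ p 2)

/-- Integration by parts against the standard Gaussian measure. -/
lemma integral_X_mul_sub_derivative_gaussianReal (p : ℤ[X]) :
    ∫ x : ℝ, aeval x (X * p - derivative p) ∂(gaussianReal 0 1) = 0 := by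
  have hint (q : ℤ[X]) : Integrable (fun x : ℝ => gaussianPDFReal 0 1 x * aeval x q) := by
    have h := integrable_aeval_gaussianReal q
    rw [gaussianReal_of_var_ne_zero _ one_ne_zero, integrable_withDensity_iff_integrable_smul'
      (measurable_gaussianPDF _ _) (.of_forall fun _ => gaussianPDF_lt_top)] at h
    simpa [toReal_gaussianPDF] using h
  have hderiv (x : ℝ) : HasDerivAt (fun x : ℝ => -(gaussianPDFReal 0 1 x * aeval x p))
      (gaussianPDFReal 0 1 x * aeval x (X * p - derivative p)) x := by
    have hpdf : HasDerivAt (gaussianPDFReal 0 1) (-x * gaussianPDFReal 0 1 x) x := by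
      rw [gaussianPDFReal_def]
      have h := ((((hasDerivAt_id x).sub_const 0).pow 2).neg.div_const
        (2 * ((1 : NNReal) : ℝ))).exp.const_mul (√(2 * Real.pi * ((1 : NNReal) : ℝ)))⁻¹
      convert! h using 1
      simp
      ring
    convert! (hpdf.mul (p.hasDerivAt_aeval x)).neg using 1
    simp
    ring
  rw [integral_gaussianReal_eq_integral_smul one_ne_zero]
  exact integral_eq_zero_of_hasDerivAt_of_integrable hderiv (hint _) (hint p).neg

/-- Pairing with the `n`-th Hermite polynomial takes the mean of the `n`-th derivative. -/
lemma integral_hermite_mul_gaussianReal (n : ℕ) (q : ℤ[X]) :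
    ∫ x : ℝ, aeval x (hermite n * q) ∂(gaussianReal 0 1) =
      ∫ x : ℝ, aeval x (derivative^[n] q) ∂(gaussianReal 0 1) := by
  induction n generalizing q with
  | zero => simp
  | succ n ih =>
    rw [Function.iterate_succ_apply, ← ih, ← sub_eq_zero,
      ← integral_sub (integrable_aeval_gaussianReal _) (integrable_aeval_gaussianReal _)]
    refine (integral_congr_ae (.of_forall fun x => ?_)).trans
      (integral_X_mul_sub_derivative_gaussianReal (hermite n * q))
    rw [← map_sub, hermite_succ, derivative_mul]
    congr 1
    ring

lemma integral_hermite_mul_hermite_gaussianReal (m n : ℕ) :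
    ∫ x : ℝ, aeval x (hermite m * hermite n) ∂(gaussianReal 0 1) =
      if m = n then (n.factorial : ℝ) else 0 := by
  have hlt {m n : ℕ} (h : m < n) :
      ∫ x : ℝ, aeval x (hermite n * hermite m) ∂(gaussianReal 0 1) = 0 := by
    rw [integral_hermite_mul_gaussianReal,
      iterate_derivative_eq_zero (by rwa [natDegree_hermite])]
    simp
  rcases lt_trichotomy m n with h | rfl | h
  · rw [if_neg h.ne, mul_comm, hlt h]
  · have hconst : derivative^[m] (hermite m) = C (m.factorial : ℤ) := by
      rw [eq_C_of_natDegree_eq_zero (p := derivative^[m] (hermite m)) (by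
        have := natDegree_iterate_derivative (hermite m) m
        rw [natDegree_hermite] at this
        omega), coeff_iterate_derivative]
      simp [Nat.descFactorial_self]
    rw [integral_hermite_mul_gaussianReal, hconst]
    simp
  · rw [if_neg h.ne', hlt h]

/-- Bessel's inequality for the Hermite polynomials. -/
lemma summable_sq_integral_mul_hermite_div_factorial {f : ℝ → ℝ}
    (hf : MemLp f 2 (gaussianReal 0 1)) :
    Summable fun n : ℕ =>
      (∫ x, f x * aeval x (hermite n) ∂(gaussianReal 0 1)) ^ 2 / (n.factorial : ℝ) := by
  have hmem (n : ℕ) := (memLp_two_aeval_gaussianReal (hermite n)).const_mul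
    (√(n.factorial : ℝ))⁻¹
  have hinner {g h : ℝ → ℝ} (hg : MemLp g 2 (gaussianReal 0 1))
      (hh : MemLp h 2 (gaussianReal 0 1)) :
      inner ℝ (hg.toLp g) (hh.toLp h) = ∫ x, h x * g x ∂(gaussianReal 0 1) := by
    rw [L2.inner_def]
    refine integral_congr_ae ?_
    filter_upwards [hg.coeFn_toLp, hh.coeFn_toLp] with x hx hx'
    simp [hx, hx']
  have horth : Orthonormal ℝ fun n => (hmem n).toLp _ := by
    rw [orthonormal_iff_ite]
    intro m n
    have h := integral_hermite_mul_hermite_gaussianReal m n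
    have hint (x : ℝ) : ((√(n.factorial : ℝ))⁻¹ * aeval x (hermite n)) *
        ((√(m.factorial : ℝ))⁻¹ * aeval x (hermite m)) =
        ((√(n.factorial : ℝ))⁻¹ * (√(m.factorial : ℝ))⁻¹) * aeval x (hermite m * hermite n) := by
      rw [map_mul]
      ring
    rw [hinner]
    simp_rw [hint]
    rw [integral_const_mul, h]
    split_ifs with hmn
    · subst hmn
      rw [← mul_inv, Real.mul_self_sqrt (by positivity), inv_mul_cancel₀ (by positivity)]
    · simp
  refine (horth.inner_products_summable (x := hf.toLp f)).congr fun n => ?_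
  have hint (x : ℝ) : f x * ((√(n.factorial : ℝ))⁻¹ * aeval x (hermite n)) =
      (√(n.factorial : ℝ))⁻¹ * (f x * aeval x (hermite n)) := by ring
  rw [hinner]
  simp_rw [hint]
  rw [integral_const_mul, Real.norm_eq_abs, sq_abs, mul_pow, inv_pow,
    Real.sq_sqrt (by positivity), mul_comm, div_eq_mul_inv]

end GaussianHermite

section FractionalCorrelation

/-- Increments of a fractional power with exponent in `[0, 1]` are decreasing. -/
lemma rpow_second_difference_nonpos {p : ℝ} (hp₀ : 0 ≤ p) (hp₁ : p ≤ 1) {x : ℝ} (hx : 0 ≤ x) :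
    x ^ p - 2 * (x + 1) ^ p + (x + 2) ^ p ≤ 0 := by
  have h := (Real.concaveOn_rpow hp₀ hp₁).slope_anti_adjacent (x := x) (y := x + 1) (z := x + 2)
    hx (Set.mem_Ici.2 (by linarith)) (by linarith) (by linarith)
  rw [show x + 2 - (x + 1) = 1 by ring, show x + 1 - x = 1 by ring] at h
  linarith

lemma sum_range_abs_rpow_second_difference_le {p : ℝ} (hp₀ : 0 < p) (hp₁ : p ≤ 1) (n : ℕ) :
    ∑ i ∈ Finset.range n, |(i : ℝ) ^ p - 2 * ((i : ℝ) + 1) ^ p + ((i : ℝ) + 2) ^ p| ≤ 1 := by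
  have hsum : ∑ i ∈ Finset.range n, |(i : ℝ) ^ p - 2 * ((i : ℝ) + 1) ^ p + ((i : ℝ) + 2) ^ p| =
      1 - (((n : ℝ) + 1) ^ p - (n : ℝ) ^ p) := by
    induction n with
    | zero => simp [hp₀.ne']
    | succ n ih =>
      rw [Finset.sum_range_succ, ih,
        abs_of_nonpos (rpow_second_difference_nonpos hp₀.le hp₁ n.cast_nonneg)]
      push_cast
      rw [show (n : ℝ) + 1 + 1 = n + 2 by ring]
      ring
  have hmono : (n : ℝ) ^ p ≤ ((n : ℝ) + 1) ^ p := by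
    gcongr
    linarith
  linarith

end FractionalCorrelation

lemma summable_abs_pow_and_abs_tsum_pow_le {r : ℕ → ℝ} {c : ℝ} (hc : c ≤ 1)
    (hr : ∀ n, ∑ i ∈ Finset.range n, |r i| ≤ c) {k : ℕ} (hk : 1 ≤ k) :
    Summable (fun i => |r i| ^ k) ∧ |∑' i, r i ^ k| ≤ c := by
  have hone (i : ℕ) : |r i| ≤ 1 :=
    ((Finset.single_le_sum (fun j _ => abs_nonneg (r j))
      (Finset.self_mem_range_succ i)).trans (hr (i + 1))).trans hc
  have hle (n : ℕ) : ∑ i ∈ Finset.range n, |r i| ^ k ≤ c :=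
    (Finset.sum_le_sum fun i _ =>
      pow_le_of_le_one (abs_nonneg _) (hone i) (Nat.one_le_iff_ne_zero.1 hk)).trans (hr n)
  have hs := summable_of_sum_range_le (fun i => pow_nonneg (abs_nonneg (r i)) k) hle
  refine ⟨hs, ?_⟩
  have hn : Summable fun i => ‖r i ^ k‖ := by simpa only [norm_pow, Real.norm_eq_abs] using hs
  refine (norm_tsum_le_tsum_norm hn).trans ?_
  simpa only [norm_pow, Real.norm_eq_abs] using
    Real.tsum_le_of_sum_range_le (fun i => pow_nonneg (abs_nonneg (r i)) k) hle

/-- Convergence of the asymptotic variance `β = ∑_{k≥1} k!·a_k²·(1 + 2∑_{i≥1} ρ_α(i)^k)`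
of the realised semivariance, where `ρ_α` are the limiting correlations for
`α ∈ (−1/2,0)` and `a_k` are the Hermite coefficients of `x²·1_{x≥0} − 1/2` with
respect to the standard Gaussian measure; in particular each inner series converges
absolutely. -/
theorem beta_series_summable (α : ℝ) (hα : α ∈ Set.Ioo (-(1/2) : ℝ) 0)
    (ρ : ℕ → ℝ)
    (hρ : ∀ j : ℕ, 1 ≤ j →
      ρ j = (1/2) * (((j : ℝ) - 1) ^ (2 * α + 1) - 2 * (j : ℝ) ^ (2 * α + 1)
        + ((j : ℝ) + 1) ^ (2 * α + 1)))
    (a : ℕ → ℝ)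
    (ha : ∀ k : ℕ, 1 ≤ k →
      a k = (1 / (Nat.factorial k : ℝ)) *
        ∫ x, (Set.indicator (Set.Ici (0 : ℝ)) (fun y => y ^ 2) x - 1 / 2) *
          Polynomial.aeval x (Polynomial.hermite k) ∂(gaussianReal 0 1)) :
    (∀ k : ℕ, 1 ≤ k → Summable (fun i : ℕ => |ρ (i + 1)| ^ k)) ∧
    Summable (fun k : ℕ =>
      (Nat.factorial (k + 1) : ℝ) * (a (k + 1)) ^ 2 *
        (1 + 2 * ∑' i : ℕ, ρ (i + 1) ^ (k + 1))) := by
  obtain ⟨hα₁, hα₂⟩ := hα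
  have hsum (n : ℕ) : ∑ i ∈ Finset.range n, |ρ (i + 1)| ≤ 1 / 2 := by
    have h := sum_range_abs_rpow_second_difference_le (p := 2 * α + 1)
      (by linarith) (by linarith) n
    have hterm (i : ℕ) : |ρ (i + 1)| = 1 / 2 * |(i : ℝ) ^ (2 * α + 1) -
        2 * ((i : ℝ) + 1) ^ (2 * α + 1) + ((i : ℝ) + 2) ^ (2 * α + 1)| := by
      rw [hρ _ (Nat.le_add_left 1 i), abs_mul, abs_of_pos (by norm_num : (0 : ℝ) < 1 / 2)]
      push_cast
      rw [show (i : ℝ) + 1 - 1 = i by ring, show (i : ℝ) + 1 + 1 = i + 2 by ring]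
    simp_rw [hterm]
    rw [← Finset.mul_sum]
    linarith
  have hpow {k : ℕ} (hk : 1 ≤ k) := summable_abs_pow_and_abs_tsum_pow_le (by norm_num) hsum hk
  refine ⟨fun k hk => (hpow hk).1, ?_⟩
  have hmem : MemLp (fun x : ℝ => Set.indicator (Set.Ici (0 : ℝ)) (fun y => y ^ 2) x - 1 / 2) 2
      (gaussianReal 0 1) := by
    have h : MemLp (fun x : ℝ => x ^ 2) 2 (gaussianReal 0 1) := by
      refine (memLp_two_aeval_gaussianReal (Polynomial.X ^ 2)).ae_eq (.of_forall fun x => ?_)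
      simp
    exact (h.indicator measurableSet_Ici).sub (memLp_const (1 / 2))
  have hcoeff : Summable fun k : ℕ => ((k + 1).factorial : ℝ) * a (k + 1) ^ 2 := by
    refine ((summable_nat_add_iff 1).2
      (summable_sq_integral_mul_hermite_div_factorial hmem)).congr fun k => ?_
    have hfac : ((k + 1).factorial : ℝ) ≠ 0 := Nat.cast_ne_zero.2 (Nat.factorial_ne_zero _)
    rw [ha _ (Nat.le_add_left 1 k), mul_pow, ← mul_assoc, mul_comm, div_eq_mul_inv]
    congr 1
    field_simp
  refine (hcoeff.mul_right 2).of_norm_bounded fun k => ?_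
  rw [norm_mul, Real.norm_of_nonneg (by positivity)]
  gcongr
  have h := abs_le.1 (hpow (Nat.le_add_left 1 k)).2
  rw [Real.norm_eq_abs, abs_le]
  constructor <;> linarith
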